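/- Let g ≥ 7. For p ≥ 0, call a (p+1)-tuple w = (v_0,…,v_p) of vectors of H a p-simplex of Λ(g) if the v_i are pairwise ω-orthogonal and gcd(v_0,…,v_p) = 1. For such a tuple w, let Λ³(w^⊥) denote the subspace of the third exterior power Λ³(ℚ^{2g}) spanned by all z_1∧z_2∧z_3 with each z_i ∈ ℚ^{2g} ω-orthogonal to every entry of w. For p ≥ 1, let C_p be the direct sum, over all (p−1)-simplices w of Λ(g), of Λ³(w^⊥), i.e. the space of finitely supported functions ξ assigning to each (p−1)-simplex w an element ξ(w) ∈ Λ³(w^⊥); define the linear map d : C_p → C_{p−1} on the summand indexed by w by sending z ∈ Λ³(w^⊥) to Σ_{j=0}^{p−1} (−1)^j · z placed in the summand indexed by ∂_j w, where ∂_j w deletes the j-th entry of w (well defined since Λ³(w^⊥) ⊆ Λ³((∂_j w)^⊥)). Then the sequence C_3 → C_2 → C_1 is exact at C_2: every ξ ∈ C_2 with dξ = 0 equals dη for some η ∈ C_3. -/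

import Mathlib

namespace Paper

/-- The standard symplectic form on `R^{2g}` with respect to the basis
`a_1, b_1, …, a_g, b_g` (coordinates `2i, 2i+1` for `a_{i+1}, b_{i+1}`). -/
def symp {R : Type*} [CommRing R] {g : ℕ} (x y : Fin (2 * g) → R) : R :=
  ∑ i : Fin g,
    (x ⟨2 * i.1, by omega⟩ * y ⟨2 * i.1 + 1, by omega⟩ -
      x ⟨2 * i.1 + 1, by omega⟩ * y ⟨2 * i.1, by omega⟩)

theorem symp_add_left {R : Type*} [CommRing R] {g : ℕ} (x y a : Fin (2 * g) → R) :
    symp (x + y) a = symp x a + symp y a := by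
  unfold symp
  rw [← Finset.sum_add_distrib]
  exact Finset.sum_congr rfl fun i _ => by simp only [Pi.add_apply]; ring

theorem symp_smul_left {R : Type*} [CommRing R] {g : ℕ} (c : R) (x a : Fin (2 * g) → R) :
    symp (c • x) a = c * symp x a := by
  unfold symp
  rw [Finset.mul_sum]
  exact Finset.sum_congr rfl fun i _ => by simp only [Pi.smul_apply, smul_eq_mul]; ring

theorem symp_zero_left {R : Type*} [CommRing R] {g : ℕ} (a : Fin (2 * g) → R) :
    symp (0 : Fin (2 * g) → R) a = 0 := by
  unfold symp; simp

/-- The orthogonal complement `A^⊥ = {x | ω(x,a) = 0 for all a ∈ A}`. -/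
def perp {R : Type*} [CommRing R] {g : ℕ} (A : Set (Fin (2 * g) → R)) :
    Submodule R (Fin (2 * g) → R) where
  carrier := {x | ∀ a ∈ A, symp x a = 0}
  add_mem' := by
    intro x y hx hy a ha
    rw [symp_add_left, hx a ha, hy a ha, add_zero]
  zero_mem' := by
    intro a ha
    exact symp_zero_left a
  smul_mem' := by
    intro c x hx a ha
    rw [symp_smul_left, hx a ha, mul_zero]

/-- The submodule of vectors whose first `m` coordinates vanish.
`H_k = coordZero R (2*g) (2*(k-1))`, and `H₂ = coordZero R (2*(g+1)) 2`. -/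
def coordZero (R : Type*) [CommRing R] (n m : ℕ) : Submodule R (Fin n → R) where
  carrier := {v | ∀ j : Fin n, (j : ℕ) < m → v j = 0}
  add_mem' := by
    intro x y hx hy j hj
    have h1 := hx j hj
    have h2 := hy j hj
    simp [Pi.add_apply, h1, h2]
  zero_mem' := by intro j hj; rfl
  smul_mem' := by
    intro c x hx j hj
    have h1 := hx j hj
    simp [Pi.smul_apply, h1]

/-- The standard basis vector `a_{i+1}` (`i` is 0-indexed). -/
def stdA (R : Type*) [CommRing R] (g i : ℕ) : Fin (2 * g) → R :=
  fun j => if (j : ℕ) = 2 * i then 1 else 0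

/-- The standard basis vector `b_{i+1}` (`i` is 0-indexed). -/
def stdB (R : Type*) [CommRing R] (g i : ℕ) : Fin (2 * g) → R :=
  fun j => if (j : ℕ) = 2 * i + 1 then 1 else 0

/-- Regard an integer vector as a rational vector. -/
def qcast {n : ℕ} (v : Fin n → ℤ) : Fin n → ℚ := fun j => (v j : ℚ)

/-- The projection `pr₂` deleting the `a_1`- and `b_1`-coordinates. -/
def pr2 {R : Type*} [CommRing R] {n : ℕ} (v : Fin n → R) : Fin n → R :=
  fun j => if (j : ℕ) < 2 then 0 else v j

/-- `gcd(v_1, …, v_m) = 1`: the vectors are linearly independent and their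
ℤ-span is a direct summand. -/
def IsUnimodular {n m : ℕ} (v : Fin m → Fin n → ℤ) : Prop :=
  LinearIndependent ℤ v ∧
    ∃ C : Submodule ℤ (Fin n → ℤ), IsCompl (Submodule.span ℤ (Set.range v)) C

/-- A primitive vector. -/
def Primitive {n : ℕ} (v : Fin n → ℤ) : Prop := IsUnimodular ![v]

/-- The entries of `w` are pairwise `ω`-orthogonal. -/
def PairwiseOrth {g m : ℕ} (w : Fin m → Fin (2 * g) → ℤ) : Prop :=
  ∀ i j, i ≠ j → symp (w i) (w j) = 0

/-- `Λ³ W`: the span of all wedges of three vectors from `W` inside the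
exterior algebra. -/
def wedge3 {g : ℕ} (W : Submodule ℚ (Fin (2 * g) → ℚ)) :
    Submodule ℚ (ExteriorAlgebra ℚ (Fin (2 * g) → ℚ)) :=
  Submodule.span ℚ {x | ∃ z₁ ∈ W, ∃ z₂ ∈ W, ∃ z₃ ∈ W,
    x = ExteriorAlgebra.ι ℚ z₁ * ExteriorAlgebra.ι ℚ z₂ * ExteriorAlgebra.ι ℚ z₃}

/-- `u ∧ Λ² W`. -/
def uWedge2 {g : ℕ} (u : Fin (2 * g) → ℚ) (W : Submodule ℚ (Fin (2 * g) → ℚ)) :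
    Submodule ℚ (ExteriorAlgebra ℚ (Fin (2 * g) → ℚ)) :=
  Submodule.span ℚ {x | ∃ z₁ ∈ W, ∃ z₂ ∈ W,
    x = ExteriorAlgebra.ι ℚ u * ExteriorAlgebra.ι ℚ z₁ * ExteriorAlgebra.ι ℚ z₂}

/-- `u ∧ u' ∧ W`. -/
def uuWedge1 {g : ℕ} (u u' : Fin (2 * g) → ℚ) (W : Submodule ℚ (Fin (2 * g) → ℚ)) :
    Submodule ℚ (ExteriorAlgebra ℚ (Fin (2 * g) → ℚ)) :=
  Submodule.span ℚ {x | ∃ z ∈ W,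
    x = ExteriorAlgebra.ι ℚ u * ExteriorAlgebra.ι ℚ u' * ExteriorAlgebra.ι ℚ z}

/-- The simplicial differential: on the summand indexed by `w` it sends `z` to
`Σ_j (-1)^j · z` placed in the summand indexed by `∂_j w`. -/
noncomputable def diff (g p : ℕ)
    (ξ : (Fin (p + 1) → Fin (2 * g) → ℤ) →₀ ExteriorAlgebra ℚ (Fin (2 * g) → ℚ)) :
    (Fin p → Fin (2 * g) → ℤ) →₀ ExteriorAlgebra ℚ (Fin (2 * g) → ℚ) :=
  ξ.sum fun w z =>
    ∑ j : Fin (p + 1), ((-1 : ℚ) ^ (j : ℕ)) • Finsupp.single (fun i => w (j.succAbove i)) z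

/-- The gcd of the determinants of all maximal square submatrices of the matrix
whose columns are the `v i`. -/
def vgcd {ι : Type*} [Fintype ι] {m : ℕ} (v : Fin m → ι → ℤ) : ℕ :=
  Finset.univ.gcd fun r : Fin m → ι => (Matrix.det (Matrix.of fun i j => v j (r i))).natAbs

/-- The lattice `ℤ^{2g}`. -/
abbrev Lat (g : ℕ) := Fin (2 * g) → ℤ

/-- The exterior algebra of `ℚ^{2g}`. -/
abbrev Ext (g : ℕ) := ExteriorAlgebra ℚ (Fin (2 * g) → ℚ)

section Symplectic

variable {R : Type*} [CommRing R] {g : ℕ}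

theorem symp_skew (x y : Fin (2 * g) → R) : symp x y = -symp y x := by
  unfold symp
  rw [← Finset.sum_neg_distrib]
  exact Finset.sum_congr rfl fun i _ => by ring

theorem symp_self (x : Fin (2 * g) → R) : symp x x = 0 := by
  unfold symp
  exact Finset.sum_eq_zero fun i _ => by ring

theorem symp_smul_right (c : R) (x a : Fin (2 * g) → R) :
    symp a (c • x) = c * symp a x := by
  rw [symp_skew, symp_smul_left, symp_skew a x]; ring

theorem symp_neg_left (x a : Fin (2 * g) → R) : symp (-x) a = -symp x a := by
  rw [← neg_one_smul R x, symp_smul_left]; ring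

theorem symp_sub_left (x y a : Fin (2 * g) → R) :
    symp (x - y) a = symp x a - symp y a := by
  rw [sub_eq_add_neg, symp_add_left, symp_neg_left]; ring

theorem symp_sub_right (x y a : Fin (2 * g) → R) :
    symp a (x - y) = symp a x - symp a y := by
  rw [symp_skew, symp_sub_left, symp_skew a x, symp_skew a y]; ring

/-- The linear functional `ω(·, a)`. -/
def sympL (a : Fin (2 * g) → R) : (Fin (2 * g) → R) →ₗ[R] R where
  toFun x := symp x a
  map_add' x y := symp_add_left x y a
  map_smul' c x := symp_smul_left c x a

@[simp] theorem sympL_apply (a x : Fin (2 * g) → R) : sympL a x = symp x a := rfl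

theorem symp_stdA {i : ℕ} (hi : i < g) (v : Fin (2 * g) → R) :
    symp (stdA R g i) v = v ⟨2 * i + 1, by omega⟩ := by
  unfold symp stdA
  rw [Finset.sum_eq_single ⟨i, hi⟩]
  · have : ¬ (2 * i + 1 = 2 * i) := by omega
    simp
  · intro j _ hj
    have h1 : j.1 ≠ i := fun h => hj (Fin.ext h)
    have h2 : ¬ (2 * j.1 + 1 = 2 * i) := by omega
    simp [h1, h2]
  · simp

theorem symp_stdB {i : ℕ} (hi : i < g) (v : Fin (2 * g) → R) :
    symp (stdB R g i) v = -v ⟨2 * i, by omega⟩ := by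
  unfold symp stdB
  rw [Finset.sum_eq_single ⟨i, hi⟩]
  · have : ¬ (2 * i = 2 * i + 1) := by omega
    simp
  · intro j _ hj
    have h1 : j.1 ≠ i := fun h => hj (Fin.ext h)
    have h2 : ¬ (2 * j.1 = 2 * i + 1) := by omega
    simp [h1, h2]
  · simp

theorem exists_symp_eq (χ : (Fin (2 * g) → R) →ₗ[R] R) :
    ∃ u : Fin (2 * g) → R, ∀ v, symp u v = χ v := by
  refine ⟨∑ i : Fin g, (χ (stdB R g i) • stdA R g i - χ (stdA R g i) • stdB R g i), ?_⟩
  intro v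
  have hs : ∀ (s : Finset (Fin g)) (F : Fin g → Fin (2 * g) → R),
      symp (∑ i ∈ s, F i) v = ∑ i ∈ s, symp (F i) v := fun s F => map_sum (sympL v) F s
  rw [hs]
  have hv : v = ∑ i : Fin g, (v ⟨2 * i.1, by omega⟩ • stdA R g i +
      v ⟨2 * i.1 + 1, by omega⟩ • stdB R g i) := by
    ext k
    rw [Finset.sum_apply, Finset.sum_eq_single ⟨k.1 / 2, by omega⟩]
    · obtain ⟨k, hk⟩ := k
      rcases Nat.even_or_odd' k with ⟨c, rfl | rfl⟩
      · have h2 : ¬ (2 * c = 2 * c + 1) := by omega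
        simp [stdA, stdB]
      · have h1 : (2 * c + 1) / 2 = c := by omega
        have h2 : ¬ (2 * c + 1 = 2 * c) := by omega
        simp [stdA, stdB, h1]
    · intro j _ hj
      have h0 : j.1 ≠ k.1 / 2 := fun h => hj (Fin.ext h)
      have h1 : ¬ (k.1 = 2 * j.1) := by omega
      have h2 : ¬ (k.1 = 2 * j.1 + 1) := by omega
      simp [stdA, stdB, h1, h2]
    · simp
  conv_rhs => rw [hv]
  rw [map_sum]
  refine Finset.sum_congr rfl fun i _ => ?_
  rw [symp_sub_left, symp_smul_left, symp_smul_left, symp_stdA i.2, symp_stdB i.2]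
  simp only [map_add, map_smul, smul_eq_mul]
  ring

end Symplectic

theorem symp_qcast {g : ℕ} (x y : Lat g) :
    symp (g := g) (qcast x) (qcast y) = ((symp x y : ℤ) : ℚ) := by
  simp [symp, qcast]

theorem isUnimodular_iff {n m : ℕ} (v : Fin m → Fin n → ℤ) :
    IsUnimodular v ↔ ∃ φ : Fin m → (Fin n → ℤ) →ₗ[ℤ] ℤ,
      ∀ i j, φ i (v j) = if i = j then 1 else 0 := by
  constructor
  · rintro ⟨hli, C, hC⟩
    refine ⟨fun i => (Module.Basis.span hli).coord i ∘ₗ Submodule.projectionOnto _ C hC, ?_⟩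
    intro i j
    have h1 : Submodule.projectionOnto _ C hC (v j) = Module.Basis.span hli j := by
      have : v j = ((Module.Basis.span hli j : Submodule.span ℤ (Set.range v)) : Fin n → ℤ) := by
        rw [Module.Basis.span_apply]
      rw [this, Submodule.projectionOnto_apply_left]
    simp [h1, Finsupp.single_apply, eq_comm]
  · rintro ⟨φ, hφ⟩
    refine ⟨?_, ?_⟩
    · rw [Fintype.linearIndependent_iff]
      intro c hc i
      have := congrArg (φ i) hc
      simpa only [map_sum, map_smul, hφ, smul_eq_mul, mul_ite, mul_one, mul_zero,
        Finset.sum_ite_eq, Finset.mem_univ, if_true, map_zero] using this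
    · let f : (Fin n → ℤ) →ₗ[ℤ] (Fin n → ℤ) := ∑ i, (φ i).smulRight (v i)
      have hf : ∀ x, f x = ∑ i, φ i x • v i := fun x => by simp [f]
      have hmem : ∀ x, f x ∈ Submodule.span ℤ (Set.range v) := fun x => by
        rw [hf]
        exact Submodule.sum_mem _ fun i _ =>
          Submodule.smul_mem _ _ (Submodule.subset_span ⟨i, rfl⟩)
      refine ⟨_, LinearMap.isCompl_of_proj (f := f.codRestrict _ hmem) ?_⟩
      rintro ⟨x, hx⟩
      apply Subtype.ext
      change f x = x
      induction hx using Submodule.span_induction with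
      | mem x hx =>
        obtain ⟨j, rfl⟩ := hx
        simp [hf, hφ]
      | zero => simp
      | add x y _ _ hx hy => rw [map_add, hx, hy]
      | smul c x _ hx => rw [map_smul, hx]

/-- In a common kernel of few functionals there are four vectors with dual functionals. -/
theorem exists_dual_vectors {n : ℕ} {ι : Type*} [Fintype ι] (ψ : ι → (Fin n → ℤ) →ₗ[ℤ] ℤ)
    (hn : Fintype.card ι + 4 ≤ n) :
    ∃ (c : Fin 4 → Fin n → ℤ) (χ : Fin 4 → (Fin n → ℤ) →ₗ[ℤ] ℤ),
      (∀ k i, ψ k (c i) = 0) ∧ ∀ i j, χ i (c j) = if i = j then 1 else 0 := by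
  let Ψ : (Fin n → ℤ) →ₗ[ℤ] (ι → ℤ) := LinearMap.pi ψ
  obtain ⟨s, hs⟩ := LinearMap.exists_rightInverse_of_surjective Ψ.rangeRestrict
    (LinearMap.range_rangeRestrict Ψ)
  have hrank : 4 ≤ Module.finrank ℤ (LinearMap.ker Ψ) := by
    have h1 := Submodule.finrank_quotient_add_finrank (LinearMap.ker Ψ)
    rw [Ψ.quotKerEquivRange.finrank_eq] at h1
    have h2 := Submodule.finrank_le (LinearMap.range Ψ)
    simp only [Module.finrank_fintype_fun_eq_card, Fintype.card_fin] at h1 h2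
    omega
  let b := Module.finBasis ℤ (LinearMap.ker Ψ)
  let P : (Fin n → ℤ) →ₗ[ℤ] (Fin n → ℤ) := LinearMap.id - s ∘ₗ Ψ.rangeRestrict
  have hP : ∀ x, P x ∈ LinearMap.ker Ψ := by
    intro x
    have := congrArg Subtype.val (LinearMap.congr_fun hs (Ψ.rangeRestrict x))
    simp only [LinearMap.comp_apply, LinearMap.id_apply] at this
    rw [LinearMap.mem_ker]
    simp only [P, LinearMap.sub_apply, LinearMap.id_apply, LinearMap.comp_apply, map_sub]
    exact sub_eq_zero.mpr this.symm
  have hPid : ∀ x : LinearMap.ker Ψ, P.codRestrict _ hP x = x := by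
    rintro ⟨x, hx⟩
    apply Subtype.ext
    have h0 : Ψ.rangeRestrict x = 0 := Subtype.ext hx
    simp [P, h0]
  refine ⟨fun i => b (Fin.castLE hrank i),
    fun i => b.coord (Fin.castLE hrank i) ∘ₗ P.codRestrict _ hP, ?_, ?_⟩
  · intro k i
    exact congrFun (b (Fin.castLE hrank i)).2 k
  · intro i j
    simp only [LinearMap.comp_apply, hPid]
    simp [Finsupp.single_apply, eq_comm]

/-- A vector and its multiplier after extracting the greatest common divisor. -/
theorem exists_primitive_part (x y : ℤ) :
    ∃ d m n r t : ℤ, x = d * m ∧ y = d * n ∧ r * m + t * n = 1 := by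
  obtain ⟨m, n, hx, hy, hu⟩ := extract_gcd x y
  have hc : IsCoprime m n := by
    rw [← gcd_isUnit_iff]; exact hu
  obtain ⟨r, t, h⟩ := hc
  exact ⟨_, m, n, r, t, hx, hy, h⟩

section Splitting

variable {g : ℕ}

/-- The endomorphism `v ↦ v - φ(v) u`. -/
def kill (φ : (Fin (2 * g) → ℚ) →ₗ[ℚ] ℚ) (u : Fin (2 * g) → ℚ) :
    (Fin (2 * g) → ℚ) →ₗ[ℚ] (Fin (2 * g) → ℚ) :=
  LinearMap.id - φ.smulRight u

theorem kill_apply (φ : (Fin (2 * g) → ℚ) →ₗ[ℚ] ℚ) (u v : Fin (2 * g) → ℚ) :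
    kill φ u v = v - φ v • u := rfl

/-- The map induced by `kill` on the exterior algebra. -/
noncomputable def extKill (φ : (Fin (2 * g) → ℚ) →ₗ[ℚ] ℚ) (u : Fin (2 * g) → ℚ) :
    Ext g →ₗ[ℚ] Ext g :=
  (ExteriorAlgebra.map (kill φ u)).toLinearMap

/-- The complement of `extKill`. -/
noncomputable def extCompl (φ : (Fin (2 * g) → ℚ) →ₗ[ℚ] ℚ) (u : Fin (2 * g) → ℚ) :
    Ext g →ₗ[ℚ] Ext g :=
  LinearMap.id - extKill φ u

theorem extKill_mul (φ : (Fin (2 * g) → ℚ) →ₗ[ℚ] ℚ) (u z₁ z₂ z₃ : Fin (2 * g) → ℚ) :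
    extKill φ u (ExteriorAlgebra.ι ℚ z₁ * ExteriorAlgebra.ι ℚ z₂ * ExteriorAlgebra.ι ℚ z₃) =
      ExteriorAlgebra.ι ℚ (kill φ u z₁) * ExteriorAlgebra.ι ℚ (kill φ u z₂) *
        ExteriorAlgebra.ι ℚ (kill φ u z₃) := by
  simp [extKill]

theorem wedge3_mono {U W : Submodule ℚ (Fin (2 * g) → ℚ)} (h : U ≤ W) :
    wedge3 U ≤ wedge3 W := by
  refine Submodule.span_mono ?_
  rintro x ⟨z₁, h₁, z₂, h₂, z₃, h₃, rfl⟩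
  exact ⟨z₁, h h₁, z₂, h h₂, z₃, h h₃, rfl⟩

theorem extKill_mem {φ : (Fin (2 * g) → ℚ) →ₗ[ℚ] ℚ} {u : Fin (2 * g) → ℚ} (hu : φ u = 1)
    {U : Submodule ℚ (Fin (2 * g) → ℚ)} (huU : u ∈ U) {z : Ext g} (hz : z ∈ wedge3 U) :
    extKill φ u z ∈ wedge3 (U ⊓ LinearMap.ker φ) := by
  have hk : ∀ v ∈ U, kill φ u v ∈ U ⊓ LinearMap.ker φ := by
    intro v hv
    refine ⟨U.sub_mem hv (U.smul_mem _ huU), ?_⟩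
    simp [kill_apply, hu]
  have : wedge3 U ≤ (wedge3 (U ⊓ LinearMap.ker φ)).comap (extKill φ u) := by
    refine Submodule.span_le.mpr ?_
    rintro x ⟨z₁, h₁, z₂, h₂, z₃, h₃, rfl⟩
    refine Submodule.subset_span ⟨_, hk _ h₁, _, hk _ h₂, _, hk _ h₃, ?_⟩
    exact extKill_mul φ u z₁ z₂ z₃
  exact this hz

/-- A three-fold wedge misses one of four dual directions. -/
theorem comp_extCompl_eq_zero (φ : Fin 4 → (Fin (2 * g) → ℚ) →ₗ[ℚ] ℚ)
    (u : Fin 4 → Fin (2 * g) → ℚ) (hφ : ∀ i j, φ i (u j) = if i = j then 1 else 0)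
    {U : Submodule ℚ (Fin (2 * g) → ℚ)} {z : Ext g} (hz : z ∈ wedge3 U) :
    (extCompl (φ 3) (u 3) ∘ₗ extCompl (φ 2) (u 2) ∘ₗ
      extCompl (φ 1) (u 1) ∘ₗ extCompl (φ 0) (u 0)) z = 0 := by
  set T := (extCompl (φ 3) (u 3) ∘ₗ extCompl (φ 2) (u 2) ∘ₗ
      extCompl (φ 1) (u 1) ∘ₗ extCompl (φ 0) (u 0)) with hT
  let S : Set (Fin (2 * g) → ℚ) := {v | ∃ a, (kill (φ a) (u a) v = v ∨ kill (φ a) (u a) v = 0) ∧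
    ∀ k, k ≠ a → kill (φ k) (u k) v = v}
  have hS : ∀ v, v ∈ Submodule.span ℚ S := by
    intro v
    have h1 : v - ∑ k, φ k v • u k ∈ S := by
      have h0 : ∀ k, kill (φ k) (u k) (v - ∑ k, φ k v • u k) = v - ∑ k, φ k v • u k := by
        intro k
        simp [kill_apply, hφ]
      exact ⟨0, Or.inl (h0 0), fun k _ => h0 k⟩
    have h2 : ∀ k, u k ∈ S := by
      intro k
      refine ⟨k, Or.inr ?_, fun j hj => ?_⟩
      · simp [kill_apply, hφ]
      · simp [kill_apply, hφ, hj]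
    have h3 : v = (v - ∑ k, φ k v • u k) + ∑ k, φ k v • u k := by abel
    rw [h3]
    exact Submodule.add_mem _ (Submodule.subset_span h1)
      (Submodule.sum_mem _ fun k _ => Submodule.smul_mem _ _ (Submodule.subset_span (h2 k)))
  have hbase : ∀ z₁ ∈ S, ∀ z₂ ∈ S, ∀ z₃ ∈ S, T (ExteriorAlgebra.ι ℚ z₁ *
      ExteriorAlgebra.ι ℚ z₂ * ExteriorAlgebra.ι ℚ z₃) = 0 := by
    rintro z₁ ⟨a, ha, ha'⟩ z₂ ⟨b, hb, hb'⟩ z₃ ⟨c, hc, hc'⟩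
    set m := ExteriorAlgebra.ι ℚ z₁ * ExteriorAlgebra.ι ℚ z₂ * ExteriorAlgebra.ι ℚ z₃ with hm
    have key : ∀ k, extCompl (φ k) (u k) m = m ∨
        extCompl (φ k) (u k) m = 0 := by
      intro k
      have e1 : kill (φ k) (u k) z₁ = z₁ ∨ kill (φ k) (u k) z₁ = 0 := by
        by_cases h : k = a
        · subst h; exact ha
        · exact Or.inl (ha' k h)
      have e2 : kill (φ k) (u k) z₂ = z₂ ∨ kill (φ k) (u k) z₂ = 0 := by
        by_cases h : k = b
        · subst h; exact hb
        · exact Or.inl (hb' k h)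
      have e3 : kill (φ k) (u k) z₃ = z₃ ∨ kill (φ k) (u k) z₃ = 0 := by
        by_cases h : k = c
        · subst h; exact hc
        · exact Or.inl (hc' k h)
      rw [extCompl, LinearMap.sub_apply, LinearMap.id_apply, hm, extKill_mul]
      rcases e1 with e1 | e1 <;> rcases e2 with e2 | e2 <;> rcases e3 with e3 | e3 <;>
        simp [e1, e2, e3]
    have hex : ∃ k, extCompl (φ k) (u k) m = 0 := by
      obtain ⟨k, h1, h2, h3⟩ : ∃ k : Fin 4, k ≠ a ∧ k ≠ b ∧ k ≠ c := by
        have : ∀ a b c : Fin 4, ∃ k : Fin 4, k ≠ a ∧ k ≠ b ∧ k ≠ c := by decide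
        exact this a b c
      refine ⟨k, ?_⟩
      rw [extCompl, LinearMap.sub_apply, LinearMap.id_apply, hm, extKill_mul, ha' k h1,
        hb' k h2, hc' k h3, sub_self]
    obtain ⟨k, hk⟩ := hex
    rw [hT]
    simp only [LinearMap.comp_apply]
    fin_cases k
    · have hk' : extCompl (φ 0) (u 0) m = 0 := hk
      simp only [hk', map_zero]
    · have hk' : extCompl (φ 1) (u 1) m = 0 := hk
      rcases key 0 with h0 | h0 <;> simp only [h0, hk', map_zero]
    · have hk' : extCompl (φ 2) (u 2) m = 0 := hk
      rcases key 0 with h0 | h0 <;> rcases key 1 with h1 | h1 <;>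
        simp only [h0, h1, hk', map_zero]
    · have hk' : extCompl (φ 3) (u 3) m = 0 := hk
      rcases key 0 with h0 | h0 <;> rcases key 1 with h1 | h1 <;> rcases key 2 with h2 | h2 <;>
        simp only [h0, h1, h2, hk', map_zero]
  clear_value T
  have h1 : ∀ z₁, ∀ z₂ ∈ S, ∀ z₃ ∈ S, T (ExteriorAlgebra.ι ℚ z₁ *
      ExteriorAlgebra.ι ℚ z₂ * ExteriorAlgebra.ι ℚ z₃) = 0 := by
    intro z₁ z₂ h₂ z₃ h₃
    induction hS z₁ using Submodule.span_induction with
    | mem x hx => exact hbase x hx z₂ h₂ z₃ h₃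
    | zero => simp
    | add x y _ _ hx hy => simp [add_mul, hx, hy]
    | smul c x _ hx => simp [hx]
  have h2 : ∀ z₁ z₂, ∀ z₃ ∈ S, T (ExteriorAlgebra.ι ℚ z₁ *
      ExteriorAlgebra.ι ℚ z₂ * ExteriorAlgebra.ι ℚ z₃) = 0 := by
    intro z₁ z₂ z₃ h₃
    induction hS z₂ using Submodule.span_induction with
    | mem x hx => exact h1 z₁ x hx z₃ h₃
    | zero => simp
    | add x y _ _ hx hy => simp [add_mul, mul_add, hx, hy]
    | smul c x _ hx => simp [hx]
  have h3 : ∀ z₁ z₂ z₃, T (ExteriorAlgebra.ι ℚ z₁ *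
      ExteriorAlgebra.ι ℚ z₂ * ExteriorAlgebra.ι ℚ z₃) = 0 := by
    intro z₁ z₂ z₃
    induction hS z₃ using Submodule.span_induction with
    | mem x hx => exact h2 z₁ z₂ x hx
    | zero => simp
    | add x y _ _ hx hy => simp [mul_add, hx, hy]
    | smul c x _ hx => simp [hx]
  have : wedge3 U ≤ LinearMap.ker T := by
    refine Submodule.span_le.mpr ?_
    rintro x ⟨z₁, -, z₂, -, z₃, -, rfl⟩
    exact h3 z₁ z₂ z₃
  exact this hz

/-- Given four vectors with dual functionals, `Λ³ U` splits compatibly into four pieces, each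
lying in `Λ³` of the kernel of one of the functionals. -/
theorem exists_splitting (φ : Fin 4 → (Fin (2 * g) → ℚ) →ₗ[ℚ] ℚ)
    (u : Fin 4 → Fin (2 * g) → ℚ) (hφ : ∀ i j, φ i (u j) = if i = j then 1 else 0) :
    ∃ π : Fin 4 → Ext g →ₗ[ℚ] Ext g, ∀ U : Submodule ℚ (Fin (2 * g) → ℚ), (∀ k, u k ∈ U) →
      ∀ z ∈ wedge3 U, ∑ k, π k z = z ∧ ∀ k, π k z ∈ wedge3 (U ⊓ LinearMap.ker (φ k)) := by
  let Q : Fin 4 → Ext g →ₗ[ℚ] Ext g := fun k => extKill (φ k) (u k)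
  let T : Fin 4 → Ext g →ₗ[ℚ] Ext g := fun k => extCompl (φ k) (u k)
  refine ⟨![Q 0, Q 1 ∘ₗ T 0, Q 2 ∘ₗ T 1 ∘ₗ T 0, Q 3 ∘ₗ T 2 ∘ₗ T 1 ∘ₗ T 0], ?_⟩
  intro U hU z hz
  have hQ : ∀ k, ∀ x ∈ wedge3 U, Q k x ∈ wedge3 (U ⊓ LinearMap.ker (φ k)) := fun k x hx =>
    extKill_mem (by simp [hφ]) (hU k) hx
  have hT : ∀ k, ∀ x ∈ wedge3 U, T k x ∈ wedge3 U := fun k x hx =>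
    Submodule.sub_mem _ hx (wedge3_mono inf_le_left (hQ k x hx))
  refine ⟨?_, ?_⟩
  · have h0 := comp_extCompl_eq_zero φ u hφ hz
    have h1 : ∀ k x, Q k x = x - T k x := fun k x => by simp [T, Q, extCompl]
    have h2 : T 3 (T 2 (T 1 (T 0 z))) = 0 := h0
    simp only [Fin.sum_univ_four, Matrix.cons_val, LinearMap.comp_apply, h1, h2]
    abel
  · intro k
    fin_cases k
    · exact hQ 0 _ hz
    · exact hQ 1 _ (hT 0 _ hz)
    · exact hQ 2 _ (hT 1 _ (hT 0 _ hz))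
    · exact hQ 3 _ (hT 2 _ (hT 1 _ (hT 0 _ hz)))

end Splitting

section Coefficients

variable {g : ℕ}

/-- The words indexing the summands of the complex. -/
def IsSimplex {p : ℕ} (w : Fin p → Lat g) : Prop := PairwiseOrth w ∧ IsUnimodular w

/-- The rational orthogonal complement of a word. -/
def perpWord {p : ℕ} (w : Fin p → Lat g) : Submodule ℚ (Fin (2 * g) → ℚ) :=
  perp (Set.range fun i => qcast (w i))

theorem mem_perpWord {p : ℕ} {w : Fin p → Lat g} {v : Fin (2 * g) → ℚ} :
    v ∈ perpWord w ↔ ∀ i, symp v (qcast (w i)) = 0 :=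
  ⟨fun h i => h _ ⟨i, rfl⟩, by rintro h _ ⟨i, rfl⟩; exact h i⟩

open Classical in
/-- The coefficients allowed at a word: `Λ³(w^⊥)` at a simplex, and zero elsewhere. -/
noncomputable def coeff {p : ℕ} (w : Fin p → Lat g) : Submodule ℚ (Ext g) :=
  if IsSimplex w then wedge3 (perpWord w) else ⊥

theorem coeff_of_isSimplex {p : ℕ} {w : Fin p → Lat g} (h : IsSimplex w) :
    coeff w = wedge3 (perpWord w) := if_pos h

theorem coeff_le {p : ℕ} {w : Fin p → Lat g} {M : Submodule ℚ (Ext g)}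
    (h : IsSimplex w → wedge3 (perpWord w) ≤ M) : coeff w ≤ M := by
  unfold coeff
  split_ifs with hw
  · exact h hw
  · exact bot_le

theorem coeff_le_coeff {p q : ℕ} {w : Fin p → Lat g} {w' : Fin q → Lat g}
    (h : IsSimplex w → IsSimplex w') (h' : perpWord w ≤ perpWord w') : coeff w ≤ coeff w' :=
  coeff_le fun hw => (wedge3_mono h').trans (coeff_of_isSimplex (h hw)).ge

theorem coeff_le_comp {p q : ℕ} (w : Fin p → Lat g) (i : Fin q → Fin p)
    (hi : Function.Injective i) : coeff w ≤ coeff fun j => w (i j) := by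
  refine coeff_le_coeff ?_ fun v hv => mem_perpWord.mpr fun j => mem_perpWord.mp hv _
  rintro ⟨ho, hu⟩
  refine ⟨fun a b hab => ho _ _ fun h => hab (hi h), ?_⟩
  obtain ⟨φ, hφ⟩ := (isUnimodular_iff w).mp hu
  refine (isUnimodular_iff _).mpr ⟨fun j => φ (i j), fun a b => ?_⟩
  simp [hφ, hi.eq_iff]

theorem coeff_cons_le {p : ℕ} (x : Lat g) (w : Fin p → Lat g) :
    coeff (Matrix.vecCons x w) ≤ coeff w :=
  coeff_le_comp (Matrix.vecCons x w) Fin.succ (Fin.succ_injective p)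

theorem coeff_le_rotate (x y z : Lat g) : coeff ![x, y, z] ≤ coeff ![y, x, z] := by
  have := coeff_le_comp ![x, y, z] ![1, 0, 2] (by decide)
  convert this using 2
  ext j
  fin_cases j <;> rfl

theorem coeff_le_delete (x y z : Lat g) : coeff ![x, y, z] ≤ coeff ![x, z] := by
  have := coeff_le_comp ![x, y, z] ![0, 2] (by decide)
  convert this using 2
  ext j
  fin_cases j <;> rfl

theorem symp_qcast_sub_smul (v : Fin (2 * g) → ℚ) (x y : Lat g) (c : ℤ) :
    symp v (qcast (x - c • y)) = symp v (qcast x) - c * symp v (qcast y) := by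
  have : qcast (x - c • y) = qcast x - (c : ℚ) • qcast y := by
    ext i; simp [qcast]
  rw [this, symp_sub_right, symp_smul_right]

/-- The coefficients do not change when multiples of one entry are subtracted from the others. -/
theorem coeff_le_shear {p : ℕ} (b : Lat g) (w : Fin p → Lat g) (q : Fin p → ℤ) :
    coeff (Matrix.vecCons b w) ≤ coeff (Matrix.vecCons b fun i => w i - q i • b) := by
  refine coeff_le_coeff ?_ ?_
  · rintro ⟨ho, hu⟩
    refine ⟨?_, ?_⟩
    · have hb : ∀ i, symp b (w i) = 0 := fun i => ho 0 i.succ (Fin.succ_ne_zero i).symm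
      have hb' : ∀ i, symp (w i) b = 0 := fun i => ho i.succ 0 (Fin.succ_ne_zero i)
      intro i j hij
      refine Fin.cases ?_ (fun i => ?_) i <;> refine Fin.cases ?_ (fun j => ?_) j <;>
        simp only [Matrix.cons_val_zero, Matrix.cons_val_succ, symp_sub_left, symp_sub_right,
          symp_smul_left, symp_smul_right, symp_self, hb, hb', mul_zero, sub_zero]
      by_cases h : i = j
      · subst h; exact symp_self _
      · exact ho i.succ j.succ fun h' => h (Fin.succ_injective _ h')
    · obtain ⟨φ, hφ⟩ := (isUnimodular_iff _).mp hu
      have h00 := hφ 0 0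
      have h0s := fun j : Fin p => hφ 0 j.succ
      have hs0 := fun i : Fin p => hφ i.succ 0
      have hss := fun i j : Fin p => hφ i.succ j.succ
      simp only [Matrix.cons_val_zero, Matrix.cons_val_succ, if_true, Fin.succ_inj,
        Fin.succ_ne_zero, if_false, (Fin.succ_ne_zero _).symm] at h00 h0s hs0 hss
      refine (isUnimodular_iff _).mpr
        ⟨Matrix.vecCons (φ 0 + ∑ i, q i • φ i.succ) fun i => φ i.succ, fun i j => ?_⟩
      refine Fin.cases ?_ (fun i => ?_) i <;> refine Fin.cases ?_ (fun j => ?_) j <;>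
        simp [h00, h0s, hs0, hss, (Fin.succ_ne_zero _).symm, -zsmul_eq_mul]
  · intro v hv
    have h0 : symp v (qcast b) = 0 := mem_perpWord.mp hv 0
    have hs : ∀ i : Fin p, symp v (qcast (w i)) = 0 := fun i => mem_perpWord.mp hv i.succ
    refine mem_perpWord.mpr fun i => ?_
    refine Fin.cases h0 (fun i => ?_) i
    simp only [Matrix.cons_val_succ, symp_qcast_sub_smul, h0, hs]
    ring

/-- A simplex may be extended by a vector having a dual orthogonal to the simplex. -/
theorem IsSimplex.cons {p : ℕ} {w : Fin p → Lat g} (hw : IsSimplex w) {f u : Lat g}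
    (hu : symp u f = 1) (hwf : ∀ i, symp (w i) f = 0) (hwu : ∀ i, symp (w i) u = 0) :
    IsSimplex (Matrix.vecCons f w) := by
  obtain ⟨ho, hun⟩ := hw
  refine ⟨?_, ?_⟩
  · intro i j hij
    refine Fin.cases ?_ (fun i => ?_) i <;> refine Fin.cases ?_ (fun j => ?_) j <;>
      simp only [Matrix.cons_val_zero, Matrix.cons_val_succ, symp_self, hwf]
    · rw [symp_skew, hwf, neg_zero]
    · by_cases h : i = j
      · subst h; exact symp_self _
      · exact ho i j h
  · obtain ⟨φ, hφ⟩ := (isUnimodular_iff _).mp hun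
    have hfu : symp f u = -1 := by rw [symp_skew, hu]
    refine (isUnimodular_iff _).mpr
      ⟨Matrix.vecCons (-sympL u) fun i => φ i + φ i f • sympL u, fun i j => ?_⟩
    refine Fin.cases ?_ (fun i => ?_) i <;> refine Fin.cases ?_ (fun j => ?_) j <;>
      simp [hφ, hfu, hwu, (Fin.succ_ne_zero _).symm]

/-- The vectors orthogonal to every entry of a list. -/
def OrthList (A : List (Lat g)) (v : Lat g) : Prop := ∀ a ∈ A, symp v a = 0

/-- Elements of `Λ³(⟨x,y⟩^⊥)` decompose along simplices `(x, y, e)` with `e` orthogonal to few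
given vectors. -/
theorem coeff_pair_le (hg : 7 ≤ g) {A : List (Lat g)} (hA : A.length ≤ 6) (x y : Lat g) :
    coeff ![x, y] ≤ ⨆ (e : Lat g) (_ : OrthList A e), coeff ![x, y, e] := by
  refine coeff_le fun hw => ?_
  obtain ⟨ho, hu⟩ := hw
  obtain ⟨φ, hφ⟩ := (isUnimodular_iff _).mp hu
  have h00 : φ 0 x = 1 := hφ 0 0
  have h01 : φ 0 y = 0 := hφ 0 1
  have h10 : φ 1 x = 0 := hφ 1 0
  have h11 : φ 1 y = 1 := hφ 1 1
  have hxy : symp x y = 0 := ho 0 1 (by decide)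
  have hyx : symp y x = 0 := ho 1 0 (by decide)
  obtain ⟨c, χ, hc, hχ⟩ := exists_dual_vectors
    (Sum.elim (fun k : Fin A.length => sympL (A.get k))
      (Sum.elim ![sympL x, sympL y] φ) : _ ⊕ (Fin 2 ⊕ Fin 2) → _)
    (by simp only [Fintype.card_sum, Fintype.card_fin]; omega)
  have hcA : ∀ i, OrthList A (c i) := by
    intro i a ha
    obtain ⟨k, rfl⟩ := List.get_of_mem ha
    exact hc (Sum.inl k) i
  have hcx : ∀ i, symp (c i) x = 0 := fun i => hc (Sum.inr (Sum.inl 0)) i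
  have hcy : ∀ i, symp (c i) y = 0 := fun i => hc (Sum.inr (Sum.inl 1)) i
  have hc0 : ∀ i, φ 0 (c i) = 0 := fun i => hc (Sum.inr (Sum.inr 0)) i
  have hc1 : ∀ i, φ 1 (c i) = 0 := fun i => hc (Sum.inr (Sum.inr 1)) i
  let χ' : Fin 4 → Lat g →ₗ[ℤ] ℤ := fun i => χ i - χ i x • φ 0 - χ i y • φ 1
  have hχx : ∀ i, χ' i x = 0 := fun i => by simp [χ', h00, h10]
  have hχy : ∀ i, χ' i y = 0 := fun i => by simp [χ', h01, h11]
  have hχc : ∀ i j, χ' i (c j) = if i = j then 1 else 0 := fun i j => by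
    simp [χ', hc0, hc1, hχ]
  have hsimp : ∀ i, IsSimplex ![x, y, c i] := by
    intro i
    refine ⟨?_, ?_⟩
    · have hcx' : symp x (c i) = 0 := by rw [symp_skew, hcx, neg_zero]
      have hcy' : symp y (c i) = 0 := by rw [symp_skew, hcy, neg_zero]
      intro a b hab
      fin_cases a <;> fin_cases b <;> simp [symp_self, hxy, hyx, hcx, hcy, hcx', hcy']
    · refine (isUnimodular_iff _).mpr ⟨![φ 0, φ 1, χ' i], fun a b => ?_⟩
      fin_cases a <;> fin_cases b <;>
        simp [h00, h01, h10, h11, hc0, hc1, hχx, hχy, hχc]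
  choose u hu using fun i => exists_symp_eq (χ' i)
  obtain ⟨π, hπ⟩ := exists_splitting (g := g) (fun i => sympL (qcast (c i)))
    (fun i => qcast (u i)) (fun i j => by
      rw [sympL_apply, symp_qcast, hu, hχc]
      by_cases h : j = i
      · simp [h]
      · simp [h, Ne.symm h])
  intro z hz
  obtain ⟨hsum, hmem⟩ := hπ _ (fun k => mem_perpWord.mpr fun i => by
    fin_cases i
    · simpa [symp_qcast, hu] using hχx k
    · simpa [symp_qcast, hu] using hχy k) z hz
  rw [← hsum]
  refine Submodule.sum_mem _ fun k _ => ?_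
  refine Submodule.mem_iSup_of_mem (c k) (Submodule.mem_iSup_of_mem (hcA k) ?_)
  rw [coeff_of_isSimplex (hsimp k)]
  refine wedge3_mono ?_ (hmem k)
  rintro v ⟨hv, hv'⟩
  refine mem_perpWord.mpr fun i => ?_
  fin_cases i
  · exact mem_perpWord.mp hv 0
  · exact mem_perpWord.mp hv 1
  · exact hv'

theorem OrthList.sub_smul {A : List (Lat g)} {x y : Lat g} (hx : OrthList A x)
    (hy : OrthList A y) (c : ℤ) : OrthList A (x - c • y) := fun a ha => by
  rw [symp_sub_left, symp_smul_left, hx a ha, hy a ha, mul_zero, sub_zero]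

theorem natAbs_emod_lt (a : ℤ) {b : ℤ} (hb : b ≠ 0) : (a % b).natAbs < b.natAbs := by
  have h1 := Int.emod_nonneg a hb
  have h2 := Int.emod_lt_abs a hb
  rw [Int.abs_eq_natAbs] at h2
  omega

/-- As `coeff_pair_le`, with the value of a functional on `e` smaller than that on `b`. -/
theorem coeff_pair_le_of_ne_zero (hg : 7 ≤ g) {A : List (Lat g)} (hA : A.length ≤ 6)
    (f x b : Lat g) (hb : OrthList A b) (hfb : symp b f ≠ 0) :
    coeff ![x, b] ≤ ⨆ (e : Lat g) (_ : OrthList A e ∧ (symp e f).natAbs < (symp b f).natAbs),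
      coeff ![x, b, e] := by
  refine (coeff_pair_le hg hA x b).trans (iSup₂_le fun e he => ?_)
  let q := symp e f / symp b f
  have hsmall : (symp (e - q • b) f).natAbs < (symp b f).natAbs := by
    have h : symp (e - q • b) f = symp e f % symp b f := by
      rw [symp_sub_left, symp_smul_left, Int.emod_def]; ring
    rw [h]
    exact natAbs_emod_lt _ hfb
  refine le_trans ?_ (le_iSup₂_of_le (e - q • b) ⟨he.sub_smul hb q, hsmall⟩ le_rfl)
  refine (coeff_le_rotate x b e).trans (le_trans ?_ (coeff_le_rotate b x _))
  have := coeff_le_shear b ![x, e] ![0, q]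
  convert this using 2
  ext j k
  fin_cases j <;> simp

end Coefficients

section Chains

variable {g : ℕ}

/-- Chains on words of length `p`. -/
abbrev Chain (g p : ℕ) := (Fin p → Lat g) →₀ Ext g

/-- The chains whose value at each word lies in a prescribed subspace. -/
def chains {p : ℕ} (T : (Fin p → Lat g) → Submodule ℚ (Ext g)) : Submodule ℚ (Chain g p) where
  carrier := {ξ | ∀ w, ξ w ∈ T w}
  add_mem' := fun hx hy w => (T w).add_mem (hx w) (hy w)
  zero_mem' := fun w => (T w).zero_mem
  smul_mem' := fun c _ hx w => (T w).smul_mem c (hx w)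

theorem chains_le {p : ℕ} {T : (Fin p → Lat g) → Submodule ℚ (Ext g)}
    {M : Submodule ℚ (Chain g p)} (h : ∀ w, T w ≤ M.comap (Finsupp.lsingle w)) :
    chains T ≤ M := by
  intro ξ hξ
  rw [← Finsupp.sum_single ξ]
  exact Submodule.sum_mem _ fun w _ => h w (hξ w)

theorem single_mem_chains {p : ℕ} {T : (Fin p → Lat g) → Submodule ℚ (Ext g)}
    {w : Fin p → Lat g} {z : Ext g} (hz : z ∈ T w) : Finsupp.single w z ∈ chains T := by
  intro w'
  by_cases h : w = w'
  · subst h; simpa using hz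
  · rw [Finsupp.single_eq_of_ne (Ne.symm h)]; exact Submodule.zero_mem _

theorem chains_mono {p : ℕ} {T T' : (Fin p → Lat g) → Submodule ℚ (Ext g)}
    (h : ∀ w, T w ≤ T' w) : chains T ≤ chains T' := fun _ hξ w => h w (hξ w)

/-- The coefficients at words with entries satisfying `P`. -/
noncomputable def cells (P : Lat g → Prop) (p : ℕ) (w : Fin p → Lat g) : Submodule ℚ (Ext g) :=
  ⨆ _ : ∀ i, P (w i), coeff w

/-- The coefficients at words in the link of `x` with entries satisfying `P`. -/
noncomputable def linkCells (P : Lat g → Prop) (x : Lat g) (p : ℕ) (w : Fin p → Lat g) :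
    Submodule ℚ (Ext g) :=
  ⨆ _ : ∀ i, P (w i), coeff (Matrix.vecCons x w)

theorem cells_mono {P P' : Lat g → Prop} (h : ∀ v, P v → P' v) (p : ℕ) (w : Fin p → Lat g) :
    cells P p w ≤ cells P' p w :=
  iSup_le fun hw => le_iSup_of_le (fun i => h _ (hw i)) le_rfl

theorem linkCells_mono {P P' : Lat g → Prop} (h : ∀ v, P v → P' v) (x : Lat g) (p : ℕ)
    (w : Fin p → Lat g) : linkCells P x p w ≤ linkCells P' x p w :=
  iSup_le fun hw => le_iSup_of_le (fun i => h _ (hw i)) le_rfl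

theorem linkCells_le_cells (P : Lat g → Prop) (x : Lat g) (p : ℕ) (w : Fin p → Lat g) :
    linkCells P x p w ≤ cells P p w :=
  iSup_le fun hw => le_iSup_of_le hw (coeff_cons_le x w)

/-- The differential as a linear map. -/
noncomputable def diffL (g p : ℕ) : Chain g (p + 1) →ₗ[ℚ] Chain g p :=
  Finsupp.lsum ℚ fun w => ∑ j : Fin (p + 1),
    ((-1 : ℚ) ^ (j : ℕ)) • Finsupp.lsingle (fun i => w (j.succAbove i))

theorem diff_eq_diffL (p : ℕ) (ξ : Chain g (p + 1)) : diff g p ξ = diffL g p ξ := by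
  unfold diff diffL
  rw [Finsupp.lsum_apply]
  refine Finsupp.sum_congr fun w _ => ?_
  simp

theorem diffL_single (p : ℕ) (w : Fin (p + 1) → Lat g) (z : Ext g) :
    diffL g p (Finsupp.single w z) = ∑ j : Fin (p + 1),
      ((-1 : ℚ) ^ (j : ℕ)) • Finsupp.single (fun i => w (j.succAbove i)) z := by
  simp [diffL]

theorem diffL_single_one (x : Lat g) (z : Ext g) :
    diffL g 0 (Finsupp.single ![x] z) = Finsupp.single ![] z := by
  rw [diffL_single, Fin.sum_univ_one, Fin.val_zero, pow_zero, one_smul]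
  congr 1

theorem diffL_single_two (x y : Lat g) (z : Ext g) :
    diffL g 1 (Finsupp.single ![x, y] z) =
      Finsupp.single ![y] z - Finsupp.single ![x] z := by
  rw [diffL_single, Fin.sum_univ_two]
  have h0 : (fun i => ![x, y] ((0 : Fin 2).succAbove i)) = ![y] := by
    ext i; fin_cases i; rfl
  have h1 : (fun i => ![x, y] ((1 : Fin 2).succAbove i)) = ![x] := by
    ext i; fin_cases i; rfl
  rw [h0, h1]
  simp [sub_eq_add_neg]

theorem diffL_single_three (x y t : Lat g) (z : Ext g) :
    diffL g 2 (Finsupp.single ![x, y, t] z) =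
      Finsupp.single ![y, t] z - Finsupp.single ![x, t] z + Finsupp.single ![x, y] z := by
  rw [diffL_single, Fin.sum_univ_three]
  have h0 : (fun i => ![x, y, t] ((0 : Fin 3).succAbove i)) = ![y, t] := by
    ext i; fin_cases i <;> rfl
  have h1 : (fun i => ![x, y, t] ((1 : Fin 3).succAbove i)) = ![x, t] := by
    ext i; fin_cases i <;> rfl
  have h2 : (fun i => ![x, y, t] ((2 : Fin 3).succAbove i)) = ![x, y] := by
    ext i; fin_cases i <;> rfl
  rw [h0, h1, h2]
  simp [sub_eq_add_neg]

theorem word_one (w : Fin 1 → Lat g) : w = ![w 0] := by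
  ext i; fin_cases i; rfl

theorem word_two (w : Fin 2 → Lat g) : w = ![w 0, w 1] := by
  ext i; fin_cases i <;> rfl

theorem word_three (w : Fin 3 → Lat g) : w = ![w 0, w 1, w 2] := by
  ext i; fin_cases i <;> rfl

theorem diffL_zero_diffL_one (ξ : Chain g 2) : diffL g 0 (diffL g 1 ξ) = 0 := by
  induction ξ using Finsupp.induction_linear with
  | zero => simp
  | add x y hx hy => rw [map_add, map_add, hx, hy, add_zero]
  | single w z =>
    rw [word_two w, diffL_single_two, map_sub, diffL_single_one, diffL_single_one, sub_self]

theorem diffL_one_diffL_two (ξ : Chain g 3) : diffL g 1 (diffL g 2 ξ) = 0 := by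
  induction ξ using Finsupp.induction_linear with
  | zero => simp
  | add x y hx hy => rw [map_add, map_add, hx, hy, add_zero]
  | single w z =>
    rw [word_three w, diffL_single_three, map_add, map_sub, diffL_single_two, diffL_single_two,
      diffL_single_two]
    abel

/-- Prepending a letter to every word. -/
noncomputable def cone {p : ℕ} (x : Lat g) : Chain g p →ₗ[ℚ] Chain g (p + 1) :=
  Finsupp.lmapDomain (Ext g) ℚ (Matrix.vecCons x)

theorem cone_single {p : ℕ} (x : Lat g) (w : Fin p → Lat g) (z : Ext g) :
    cone x (Finsupp.single w z) = Finsupp.single (Matrix.vecCons x w) z := by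
  simp [cone]

theorem diffL_cone {p : ℕ} (x : Lat g) (ξ : Chain g (p + 1)) :
    diffL g (p + 1) (cone x ξ) = ξ - cone x (diffL g p ξ) := by
  induction ξ using Finsupp.induction_linear with
  | zero => simp
  | add a b ha hb => rw [map_add, map_add, ha, hb, map_add, map_add]; abel
  | single w z =>
    rw [cone_single, diffL_single, Fin.sum_univ_succ, diffL_single, map_sum, sub_eq_add_neg,
      ← Finset.sum_neg_distrib]
    congr 1
    · simp
    · refine Finset.sum_congr rfl fun j _ => ?_
      rw [map_smul, cone_single, Fin.val_succ, pow_succ, mul_neg_one, neg_smul]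
      congr 3
      ext i : 1
      refine Fin.cases ?_ (fun i => ?_) i <;> simp

/-- Applying a map to every letter. -/
noncomputable def mapLetters {p : ℕ} (r : Lat g → Lat g) : Chain g p →ₗ[ℚ] Chain g p :=
  Finsupp.lmapDomain (Ext g) ℚ fun w i => r (w i)

theorem mapLetters_single {p : ℕ} (r : Lat g → Lat g) (w : Fin p → Lat g) (z : Ext g) :
    mapLetters r (Finsupp.single w z) = Finsupp.single (fun i => r (w i)) z := by
  simp [mapLetters]

theorem diffL_mapLetters {p : ℕ} (r : Lat g → Lat g) (ξ : Chain g (p + 1)) :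
    diffL g p (mapLetters r ξ) = mapLetters r (diffL g p ξ) := by
  induction ξ using Finsupp.induction_linear with
  | zero => simp
  | add a b ha hb => simp only [map_add, ha, hb]
  | single w z => simp only [mapLetters_single, diffL_single, map_sum, map_smul]

/-- Applying a linear map to every coefficient. -/
noncomputable def mapCoeff {p : ℕ} (π : Ext g →ₗ[ℚ] Ext g) : Chain g p →ₗ[ℚ] Chain g p :=
  Finsupp.mapRange.linearMap π

theorem mapCoeff_single {p : ℕ} (π : Ext g →ₗ[ℚ] Ext g) (w : Fin p → Lat g) (z : Ext g) :
    mapCoeff π (Finsupp.single w z) = Finsupp.single w (π z) := by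
  simp [mapCoeff]

theorem diffL_mapCoeff {p : ℕ} (π : Ext g →ₗ[ℚ] Ext g) (ξ : Chain g (p + 1)) :
    diffL g p (mapCoeff π ξ) = mapCoeff π (diffL g p ξ) := by
  induction ξ using Finsupp.induction_linear with
  | zero => simp
  | add a b ha hb => simp only [map_add, ha, hb]
  | single w z => simp only [mapCoeff_single, diffL_single, map_sum, map_smul]

/-- The part of a chain on words with first letter `b`, with that letter removed. -/
noncomputable def linkPart {p : ℕ} (b : Lat g) : Chain g (p + 1) →ₗ[ℚ] Chain g p :=
  Finsupp.lcomapDomain (Matrix.vecCons b) fun _ _ h => (Matrix.vecCons_inj.mp h).2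

theorem linkPart_apply {p : ℕ} (b : Lat g) (ξ : Chain g (p + 1)) (w : Fin p → Lat g) :
    linkPart b ξ w = ξ (Matrix.vecCons b w) := rfl

theorem linkPart_single {p : ℕ} (b x : Lat g) (w : Fin p → Lat g) (z : Ext g) :
    linkPart b (Finsupp.single (Matrix.vecCons x w) z) =
      if x = b then Finsupp.single w z else 0 := by
  ext w' : 1
  rw [linkPart_apply]
  classical
  by_cases h : x = b
  · simp [Finsupp.single_apply, h, Matrix.vecCons_inj]
  · simp [h, Matrix.vecCons_inj]

theorem cone_linkPart_apply {p : ℕ} (b : Lat g) (ξ : Chain g (p + 1)) (w : Fin (p + 1) → Lat g) :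
    cone b (linkPart b ξ) w = if w 0 = b then ξ w else 0 := by
  have hinj : Function.Injective (Matrix.vecCons b : (Fin p → Lat g) → _) :=
    fun _ _ h => (Matrix.vecCons_inj.mp h).2
  split_ifs with h
  · obtain ⟨w', rfl⟩ : ∃ w', w = Matrix.vecCons b w' :=
      ⟨Matrix.vecTail w, by rw [← h]; exact (Matrix.cons_head_tail w).symm⟩
    exact Finsupp.mapDomain_apply hinj _ _
  · refine Finsupp.mapDomain_of_notMem_range _ _ ?_
    rintro ⟨w', rfl⟩
    exact h rfl

end Chains

section Frames

variable {g : ℕ}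

theorem symp_stdA_stdA {i : ℕ} (hi : i < g) (j : ℕ) : symp (stdA ℤ g i) (stdA ℤ g j) = 0 := by
  rw [symp_stdA hi, stdA, if_neg]
  simp only
  omega

theorem symp_stdB_stdB {i : ℕ} (hi : i < g) (j : ℕ) : symp (stdB ℤ g i) (stdB ℤ g j) = 0 := by
  rw [symp_stdB hi, stdB, if_neg, neg_zero]
  simp only
  omega

theorem symp_stdA_stdB {i : ℕ} (hi : i < g) (j : ℕ) :
    symp (stdA ℤ g i) (stdB ℤ g j) = if i = j then 1 else 0 := by
  rw [symp_stdA hi, stdB]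
  simp

theorem symp_stdB_stdA {i : ℕ} (hi : i < g) (j : ℕ) :
    symp (stdB ℤ g i) (stdA ℤ g j) = if i = j then -1 else 0 := by
  rw [symp_stdB hi, stdA]
  by_cases h : i = j <;> simp [h]

/-- Four vectors with dual vectors `u` orthogonal to everything the given ones are orthogonal to. -/
structure IsFrame (f u : Fin 4 → Lat g) : Prop where
  dual : ∀ i j, symp (u j) (f i) = if i = j then 1 else 0
  perp : ∀ w, (∀ i, symp w (f i) = 0) → ∀ i, symp w (u i) = 0

theorem isFrame_of_pairs {p p' q q' : Lat g} (hp : symp p p' = 1) (hq : symp q q' = 1)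
    (h₁ : symp p q = 0) (h₂ : symp p q' = 0) (h₃ : symp p' q = 0) (h₄ : symp p' q' = 0) :
    IsFrame ![p, p', q, q'] ![-p', p, -q', q] := by
  have hp' : symp p' p = -1 := by rw [symp_skew, hp]
  have hq' : symp q' q = -1 := by rw [symp_skew, hq]
  have h₁' : symp q p = 0 := by rw [symp_skew, h₁, neg_zero]
  have h₂' : symp q' p = 0 := by rw [symp_skew, h₂, neg_zero]
  have h₃' : symp q p' = 0 := by rw [symp_skew, h₃, neg_zero]
  have h₄' : symp q' p' = 0 := by rw [symp_skew, h₄, neg_zero]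
  refine ⟨fun i j => ?_, fun w hw i => ?_⟩
  · fin_cases i <;> fin_cases j <;>
      simp [symp_neg_left, symp_self, hp, hq, hp', hq', h₁, h₂, h₃, h₄, h₁', h₂', h₃', h₄']
  · have h0 : symp w p = 0 := hw 0
    have h1 : symp w p' = 0 := hw 1
    have h2 : symp w q = 0 := hw 2
    have h3 : symp w q' = 0 := hw 3
    have hneg : ∀ v, symp w (-v) = -symp w v := fun v => by
      rw [symp_skew, symp_neg_left, ← symp_skew]
    fin_cases i <;> simp [hneg, h0, h1, h2, h3]

/-- Two blocks of the standard basis contain a hyperbolic pair orthogonal to a given vector. -/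
theorem exists_hyperbolic_pair {k l : ℕ} (hk : k < g) (hl : l < g) (hkl : k ≠ l) (x : Lat g) :
    ∃ p p' : Lat g, symp p p' = 1 ∧ symp p x = 0 ∧ symp p' x = 0 ∧
      ∀ y, symp (stdA ℤ g k) y = 0 → symp (stdB ℤ g k) y = 0 → symp (stdA ℤ g l) y = 0 →
        symp (stdB ℤ g l) y = 0 → symp p y = 0 ∧ symp p' y = 0 := by
  obtain ⟨d₁, m₁, n₁, r₁, t₁, hm₁, hn₁, h₁⟩ :=
    exists_primitive_part (-symp (stdB ℤ g k) x) (symp (stdA ℤ g k) x)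
  obtain ⟨d₂, m₂, n₂, r₂, t₂, hm₂, hn₂, h₂⟩ :=
    exists_primitive_part (-symp (stdB ℤ g l) x) (symp (stdA ℤ g l) x)
  obtain ⟨d, α, β, s, t, hα, hβ, h⟩ := exists_primitive_part d₁ d₂
  have hm₁' : symp (stdB ℤ g k) x = -(d₁ * m₁) := by linarith
  have hm₂' : symp (stdB ℤ g l) x = -(d₂ * m₂) := by linarith
  refine ⟨t • (m₁ • stdA ℤ g k + n₁ • stdB ℤ g k) - s • (m₂ • stdA ℤ g l + n₂ • stdB ℤ g l),
    β • (r₁ • stdB ℤ g k - t₁ • stdA ℤ g k) - α • (r₂ • stdB ℤ g l - t₂ • stdA ℤ g l),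
    ?_, ?_, ?_, fun y h1 h2 h3 h4 => ⟨?_, ?_⟩⟩
  · simp only [symp_sub_left, symp_add_left, symp_smul_left, symp_sub_right,
      symp_smul_right, symp_stdA_stdA hk, symp_stdA_stdA hl, symp_stdB_stdB hk, symp_stdB_stdB hl,
      symp_stdA_stdB hk, symp_stdA_stdB hl, symp_stdB_stdA hk, symp_stdB_stdA hl, if_true,
      if_neg hkl, if_neg hkl.symm]
    linear_combination t * β * h₁ + s * α * h₂ + h
  · simp only [symp_sub_left, symp_add_left, symp_smul_left, hm₁', hm₂', hn₁, hn₂]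
    ring
  · simp only [symp_sub_left, symp_smul_left, hm₁', hm₂', hn₁, hn₂]
    linear_combination (-β * d₁) * h₁ + α * d₂ * h₂ - β * hα + α * hβ
  · simp only [symp_sub_left, symp_add_left, symp_smul_left, h1, h2, h3, h4]
    ring
  · simp only [symp_sub_left, symp_smul_left, h1, h2, h3, h4]
    ring

/-- The first two pairs of the standard basis. -/
def stdFrame (g : ℕ) : Fin 4 → Lat g := ![stdA ℤ g 0, stdB ℤ g 0, stdA ℤ g 1, stdB ℤ g 1]

theorem exists_isFrame_stdFrame (hg : 7 ≤ g) : ∃ u, IsFrame (stdFrame g) u := by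
  have h0 : 0 < g := by omega
  have h1 : 1 < g := by omega
  exact ⟨_, isFrame_of_pairs (by rw [symp_stdA_stdB h0, if_pos rfl])
    (by rw [symp_stdA_stdB h1, if_pos rfl]) (symp_stdA_stdA h0 1)
    (by rw [symp_stdA_stdB h0, if_neg zero_ne_one])
    (by rw [symp_stdB_stdA h0, if_neg zero_ne_one]) (symp_stdB_stdB h0 1)⟩

/-- There is a frame orthogonal to the standard one and to a given vector. -/
theorem exists_isFrame (hg : 7 ≤ g) (x : Lat g) : ∃ f u, IsFrame f u ∧
    (∀ k i, symp (f k) (stdFrame g i) = 0) ∧ ∀ k, symp x (f k) = 0 := by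
  obtain ⟨p, p', hp, hpx, hpx', hpy⟩ :=
    exists_hyperbolic_pair (k := 2) (l := 3) (by omega : 2 < g) (by omega) (by decide) x
  obtain ⟨q, q', hq, hqx, hqx', hqy⟩ :=
    exists_hyperbolic_pair (k := 4) (l := 5) (by omega : 4 < g) (by omega) (by decide) x
  have hA : ∀ i j : ℕ, i < 4 → 4 ≤ j → j < 6 →
      symp (stdA ℤ g j) (stdA ℤ g i) = 0 ∧ symp (stdA ℤ g j) (stdB ℤ g i) = 0 ∧
      symp (stdB ℤ g j) (stdA ℤ g i) = 0 ∧ symp (stdB ℤ g j) (stdB ℤ g i) = 0 := by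
    intro i j hi hj hj'
    have hjg : j < g := by omega
    have hji : j ≠ i := by omega
    exact ⟨symp_stdA_stdA hjg i, by rw [symp_stdA_stdB hjg, if_neg hji],
      by rw [symp_stdB_stdA hjg, if_neg hji], symp_stdB_stdB hjg i⟩
  have hB : ∀ i j : ℕ, i < 2 → 2 ≤ j → j < 4 →
      symp (stdA ℤ g j) (stdA ℤ g i) = 0 ∧ symp (stdA ℤ g j) (stdB ℤ g i) = 0 ∧
      symp (stdB ℤ g j) (stdA ℤ g i) = 0 ∧ symp (stdB ℤ g j) (stdB ℤ g i) = 0 := by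
    intro i j hi hj hj'
    have hjg : j < g := by omega
    have hji : j ≠ i := by omega
    exact ⟨symp_stdA_stdA hjg i, by rw [symp_stdA_stdB hjg, if_neg hji],
      by rw [symp_stdB_stdA hjg, if_neg hji], symp_stdB_stdB hjg i⟩
  have hqA : ∀ i < 4, symp q (stdA ℤ g i) = 0 ∧ symp q' (stdA ℤ g i) = 0 := fun i hi =>
    hqy _ (hA i 4 hi (by omega) (by omega)).1 (hA i 4 hi (by omega) (by omega)).2.2.1
      (hA i 5 hi (by omega) (by omega)).1 (hA i 5 hi (by omega) (by omega)).2.2.1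
  have hqB : ∀ i < 4, symp q (stdB ℤ g i) = 0 ∧ symp q' (stdB ℤ g i) = 0 := fun i hi =>
    hqy _ (hA i 4 hi (by omega) (by omega)).2.1 (hA i 4 hi (by omega) (by omega)).2.2.2
      (hA i 5 hi (by omega) (by omega)).2.1 (hA i 5 hi (by omega) (by omega)).2.2.2
  have hpA : ∀ i < 2, symp p (stdA ℤ g i) = 0 ∧ symp p' (stdA ℤ g i) = 0 := fun i hi =>
    hpy _ (hB i 2 hi (by omega) (by omega)).1 (hB i 2 hi (by omega) (by omega)).2.2.1
      (hB i 3 hi (by omega) (by omega)).1 (hB i 3 hi (by omega) (by omega)).2.2.1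
  have hpB : ∀ i < 2, symp p (stdB ℤ g i) = 0 ∧ symp p' (stdB ℤ g i) = 0 := fun i hi =>
    hpy _ (hB i 2 hi (by omega) (by omega)).2.1 (hB i 2 hi (by omega) (by omega)).2.2.2
      (hB i 3 hi (by omega) (by omega)).2.1 (hB i 3 hi (by omega) (by omega)).2.2.2
  have hflip : ∀ a b : Lat g, symp a b = 0 → symp b a = 0 := fun a b h => by
    rw [symp_skew, h, neg_zero]
  have hpq := hpy q (hflip _ _ (hqA 2 (by omega)).1) (hflip _ _ (hqB 2 (by omega)).1)
    (hflip _ _ (hqA 3 (by omega)).1) (hflip _ _ (hqB 3 (by omega)).1)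
  have hpq' := hpy q' (hflip _ _ (hqA 2 (by omega)).2) (hflip _ _ (hqB 2 (by omega)).2)
    (hflip _ _ (hqA 3 (by omega)).2) (hflip _ _ (hqB 3 (by omega)).2)
  refine ⟨_, _, isFrame_of_pairs hp hq hpq.1 hpq'.1 hpq.2 hpq'.2, fun k i => ?_, fun k => ?_⟩
  · fin_cases k <;> fin_cases i
    exacts [(hpA 0 (by omega)).1, (hpB 0 (by omega)).1, (hpA 1 (by omega)).1, (hpB 1 (by omega)).1,
      (hpA 0 (by omega)).2, (hpB 0 (by omega)).2, (hpA 1 (by omega)).2, (hpB 1 (by omega)).2,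
      (hqA 0 (by omega)).1, (hqB 0 (by omega)).1, (hqA 1 (by omega)).1, (hqB 1 (by omega)).1,
      (hqA 0 (by omega)).2, (hqB 0 (by omega)).2, (hqA 1 (by omega)).2, (hqB 1 (by omega)).2]
  · fin_cases k
    exacts [hflip _ _ hpx, hflip _ _ hpx', hflip _ _ hqx, hflip _ _ hqx']

/-- The coefficients at a word orthogonal to a frame split along the frame. -/
theorem IsFrame.exists_splitting {f u : Fin 4 → Lat g} (h : IsFrame f u) :
    ∃ π : Fin 4 → Ext g →ₗ[ℚ] Ext g, ∀ {p : ℕ} (w : Fin p → Lat g),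
      (∀ i k, symp (w i) (f k) = 0) → ∀ z ∈ coeff w,
        ∑ k, π k z = z ∧ ∀ k, π k z ∈ coeff (Matrix.vecCons (f k) w) := by
  obtain ⟨π, hπ⟩ := Paper.exists_splitting (g := g) (fun i => sympL (qcast (f i)))
    (fun i => qcast (u i)) (fun i j => by
      rw [sympL_apply, symp_qcast, h.dual]
      split_ifs <;> simp)
  refine ⟨π, fun {p} w hw z hz => ?_⟩
  have hwu : ∀ i k, symp (w i) (u k) = 0 := fun i => h.perp _ (hw i)
  by_cases hs : IsSimplex w
  · rw [coeff_of_isSimplex hs] at hz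
    obtain ⟨h1, h2⟩ := hπ (perpWord w) (fun k => mem_perpWord.mpr fun i => by
      rw [symp_qcast, symp_skew, hwu, neg_zero, Int.cast_zero]) z hz
    refine ⟨h1, fun k => ?_⟩
    rw [coeff_of_isSimplex (hs.cons (by rw [h.dual, if_pos rfl]) (fun i => hw i k)
      fun i => hwu i k)]
    refine wedge3_mono ?_ (h2 k)
    rintro v ⟨hv, hv'⟩
    refine mem_perpWord.mpr fun i => ?_
    refine Fin.cases hv' (fun i => ?_) i
    exact mem_perpWord.mp hv i
  · have hz0 : z = 0 := by simpa [coeff, hs] using hz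
    simp [hz0]

end Frames

section Filling

variable {g : ℕ}

theorem mem_iSup_prop {M : Type*} [AddCommGroup M] [Module ℚ M] {P : Prop} {S : Submodule ℚ M}
    {z : M} : z ∈ ⨆ _ : P, S ↔ z = 0 ∨ P ∧ z ∈ S := by
  by_cases h : P
  · simp only [h, iSup_pos, true_and]
    exact ⟨Or.inr, fun h' => h'.elim (fun h0 => h0 ▸ S.zero_mem) id⟩
  · simp [h]

/-- Closed chains with compatibly splitting coefficients bound. -/
theorem exists_filling {p : ℕ} {T : (Fin (p + 1) → Lat g) → Submodule ℚ (Ext g)}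
    {T' : (Fin (p + 2) → Lat g) → Submodule ℚ (Ext g)} (f : Fin 4 → Lat g)
    (π : Fin 4 → Ext g →ₗ[ℚ] Ext g)
    (hπ : ∀ w, ∀ z ∈ T w, ∑ k, π k z = z ∧ ∀ k, π k z ∈ T' (Matrix.vecCons (f k) w))
    {ξ : Chain g (p + 1)} (hξ : ξ ∈ chains T) (hd : diffL g p ξ = 0) :
    ∃ η ∈ chains T', diffL g (p + 1) η = ξ := by
  refine ⟨∑ k, cone (f k) (mapCoeff (π k) ξ), Submodule.sum_mem _ fun k _ => ?_, ?_⟩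
  · have : chains T ≤ (chains T').comap (cone (f k) ∘ₗ mapCoeff (π k)) := by
      refine chains_le fun w z hz => ?_
      change cone (f k) (mapCoeff (π k) (Finsupp.single w z)) ∈ chains T'
      rw [mapCoeff_single, cone_single]
      exact single_mem_chains ((hπ w z hz).2 k)
    exact this hξ
  · simp only [map_sum, diffL_cone, diffL_mapCoeff, hd, map_zero, sub_zero]
    ext w : 1
    rw [Finsupp.finsetSum_apply]
    exact (hπ w (ξ w) (hξ w)).1

/-- Trading the last letter for one orthogonal to `f`, inside a link. -/
theorem chains_linkCells_le (hg : 7 ≤ g) {A : List (Lat g)} (hA : A.length ≤ 6) (f x : Lat g) :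
    chains (linkCells (OrthList A) x 1) ≤ chains (linkCells (OrthList (f :: A)) x 1) ⊔
      (chains (linkCells (OrthList A) x 2)).map (diffL g 1) := by
  set M := chains (linkCells (OrthList (f :: A)) x 1) ⊔
      (chains (linkCells (OrthList A) x 2)).map (diffL g 1) with hM
  have key : ∀ n : ℕ, ∀ b, (symp b f).natAbs = n → OrthList A b →
      coeff ![x, b] ≤ M.comap (Finsupp.lsingle ![b]) := by
    intro n
    induction n using Nat.strong_induction_on with
    | _ n ih =>
      intro b hbn hb
      by_cases hfb : symp b f = 0
      · intro z hz
        refine Submodule.mem_sup_left (single_mem_chains (mem_iSup_prop.mpr (Or.inr ⟨?_, hz⟩)))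
        intro i
        rw [Matrix.cons_val_fin_one]
        exact List.forall_mem_cons.mpr ⟨hfb, hb⟩
      · refine (coeff_pair_le_of_ne_zero hg hA f x b hb hfb).trans (iSup₂_le fun e he z hz => ?_)
        have h1 : Finsupp.single ![e] z ∈ M :=
          ih _ (hbn ▸ he.2) e rfl he.1 (coeff_le_delete x b e hz)
        have h2 : diffL g 1 (Finsupp.single ![b, e] z) ∈ M := by
          refine Submodule.mem_sup_right (Submodule.mem_map_of_mem
            (single_mem_chains (mem_iSup_prop.mpr (Or.inr ⟨?_, hz⟩))))
          intro i
          fin_cases i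
          exacts [hb, he.1]
        have h3 := M.sub_mem h1 h2
        rw [diffL_single_two, sub_sub_cancel] at h3
        exact h3
  refine chains_le fun w => iSup_le fun hw => ?_
  have := key _ (w 0) rfl (hw 0)
  rw [← word_one w] at this
  exact this

/-- Iterating `chains_linkCells_le`. -/
theorem chains_linkCells_le_append (hg : 7 ≤ g) {A : List (Lat g)} (x : Lat g)
    (F : List (Lat g)) (hF : F.length + A.length ≤ 7) :
    chains (linkCells (OrthList A) x 1) ≤ chains (linkCells (OrthList (F ++ A)) x 1) ⊔
      (chains (linkCells (OrthList A) x 2)).map (diffL g 1) := by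
  induction F with
  | nil => exact le_sup_left
  | cons f F ih =>
    rw [List.length_cons] at hF
    refine (ih (by omega)).trans (sup_le ?_ le_sup_right)
    refine (chains_linkCells_le hg (by rw [List.length_append]; omega) f x).trans
      (sup_le_sup_left (Submodule.map_mono (chains_mono (linkCells_mono ?_ x 2))) _)
    exact fun v hv a ha => hv a (List.mem_append_right F ha)

/-- Links are acyclic in degree one, with a few orthogonality conditions imposed on the letters. -/
theorem exists_filling_link (hg : 7 ≤ g) {A : List (Lat g)} (hA : A.length ≤ 3)
    {f u : Fin 4 → Lat g} (hf : IsFrame f u) (hfA : ∀ k, OrthList A (f k)) {x : Lat g}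
    (hx : ∀ k, symp x (f k) = 0) {ζ : Chain g 1} (hζ : ζ ∈ chains (linkCells (OrthList A) x 1))
    (hd : diffL g 0 ζ = 0) :
    ∃ η ∈ chains (linkCells (OrthList A) x 2), diffL g 1 η = ζ := by
  obtain ⟨ζ', hζ', _, ⟨η₀, hη₀, rfl⟩, rfl⟩ := Submodule.mem_sup.mp
    (chains_linkCells_le_append hg x (List.ofFn f) (by rw [List.length_ofFn]; omega) hζ)
  rw [map_add, diffL_zero_diffL_one, add_zero] at hd
  obtain ⟨π, hπ⟩ := hf.exists_splitting
  obtain ⟨η, hη, hdη⟩ := exists_filling (T' := linkCells (OrthList A) x 2) f π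
    (fun w z hz => by
      rcases mem_iSup_prop.mp hz with rfl | ⟨hw, hz⟩
      · simp
      have hwA : ∀ i, OrthList A (w i) := fun i a ha => hw i a (List.mem_append_right _ ha)
      have hwf : ∀ i k, symp (w i) (f k) = 0 := fun i k =>
        hw i _ (List.mem_append_left _ (List.mem_ofFn.mpr ⟨k, rfl⟩))
      obtain ⟨h1, h2⟩ := hπ (Matrix.vecCons x w)
        (fun i k => Fin.cases (hx k) (fun i => hwf i k) i) z hz
      refine ⟨h1, fun k => mem_iSup_prop.mpr (Or.inr ⟨fun i => ?_, ?_⟩)⟩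
      · exact Fin.cases (hfA k) hwA i
      · have h3 := h2 k
        rw [word_one w] at h3 ⊢
        exact coeff_le_rotate _ _ _ h3) hζ' hd
  exact ⟨η + η₀, Submodule.add_mem _ hη hη₀, by rw [map_add, hdη]⟩

/-- The boundaries in degree two. -/
noncomputable def boundaries (g : ℕ) : Submodule ℚ (Chain g 2) :=
  (chains (cells (fun _ => True) 3)).map (diffL g 2)

theorem diffL_eq_zero_of_mem_boundaries {ξ : Chain g 2} (h : ξ ∈ boundaries g) :
    diffL g 1 ξ = 0 := by
  obtain ⟨η, -, rfl⟩ := h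
  exact diffL_one_diffL_two η

/-- The vectors orthogonal to a list with bounded pairing with `f`. -/
def SmallOrth (A : List (Lat g)) (f : Lat g) (R : ℕ) (v : Lat g) : Prop :=
  OrthList A v ∧ (symp v f).natAbs ≤ R

/-- The coefficients at words whose second letter has smaller pairing with `f` than allowed for
the first one. -/
noncomputable def steepCells (A : List (Lat g)) (f : Lat g) (R : ℕ) (w : Fin 2 → Lat g) :
    Submodule ℚ (Ext g) :=
  ⨆ _ : SmallOrth A f (R + 1) (w 0) ∧ SmallOrth A f R (w 1), coeff w

theorem chains_cells_le_steepCells (hg : 7 ≤ g) {A : List (Lat g)} (hA : A.length ≤ 6)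
    (f : Lat g) (R : ℕ) :
    chains (cells (SmallOrth A f (R + 1)) 2) ≤ chains (steepCells A f R) ⊔ boundaries g := by
  refine chains_le fun w => iSup_le fun hw => ?_
  obtain ⟨x, b, rfl⟩ : ∃ x b, w = ![x, b] := ⟨_, _, word_two w⟩
  have hx : SmallOrth A f (R + 1) x := hw 0
  have hb : SmallOrth A f (R + 1) b := hw 1
  by_cases hbR : (symp b f).natAbs ≤ R
  · intro z hz
    exact Submodule.mem_sup_left (single_mem_chains (mem_iSup_prop.mpr
      (Or.inr ⟨⟨hx, hb.1, hbR⟩, hz⟩)))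
  · have hb0 : symp b f ≠ 0 := fun h => hbR (by rw [h]; simp)
    refine (coeff_pair_le_of_ne_zero hg hA f x b hb.1 hb0).trans (iSup₂_le fun e he z hz => ?_)
    have heR : SmallOrth A f R e := ⟨he.1, by have := he.2; have := hb.2; omega⟩
    have h1 : Finsupp.single ![b, e] z ∈ chains (steepCells A f R) :=
      single_mem_chains (mem_iSup_prop.mpr (Or.inr ⟨⟨hb, heR⟩, coeff_cons_le x ![b, e] hz⟩))
    have h2 : Finsupp.single ![x, e] z ∈ chains (steepCells A f R) :=
      single_mem_chains (mem_iSup_prop.mpr (Or.inr ⟨⟨hx, heR⟩, coeff_le_delete x b e hz⟩))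
    have h3 : diffL g 2 (Finsupp.single ![x, b, e] z) ∈ boundaries g :=
      Submodule.mem_map_of_mem (single_mem_chains
        (mem_iSup_prop.mpr (Or.inr ⟨fun _ => trivial, hz⟩)))
    have h4 := Submodule.add_mem_sup (Submodule.sub_mem _ h2 h1) h3
    rw [diffL_single_three] at h4
    rw [Submodule.mem_comap, Finsupp.lsingle_apply]
    convert h4 using 1
    abel

/-- The link part of a closed chain at a letter with maximal pairing is closed. -/
theorem diffL_linkPart_eq_zero {A : List (Lat g)} {f b : Lat g} {R : ℕ}
    (hb : R < (symp b f).natAbs) {ξ : Chain g 2} (hξ : ξ ∈ chains (steepCells A f R))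
    (hd : diffL g 1 ξ = 0) : diffL g 0 (linkPart b ξ) = 0 := by
  have key : chains (steepCells A f R) ≤
      LinearMap.ker (diffL g 0 ∘ₗ linkPart b + linkPart b ∘ₗ diffL g 1) := by
    refine chains_le fun w => iSup_le fun hw => ?_
    obtain ⟨x, y, rfl⟩ : ∃ x y, w = ![x, y] := ⟨_, _, word_two w⟩
    have hyb : y ≠ b := by
      rintro rfl
      exact absurd hw.2.2 (not_le.mpr hb)
    intro z _
    rw [Submodule.mem_comap, LinearMap.mem_ker, Finsupp.lsingle_apply, LinearMap.add_apply,
      LinearMap.comp_apply, LinearMap.comp_apply, diffL_single_two, map_sub, linkPart_single,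
      linkPart_single, linkPart_single, if_neg hyb]
    split_ifs with h
    · rw [diffL_single_one]; simp
    · simp
  have h := key hξ
  rw [LinearMap.mem_ker, LinearMap.add_apply, LinearMap.comp_apply, LinearMap.comp_apply, hd,
    map_zero, add_zero] at h
  exact h

/-- Filling the link of `b` by letters with smaller pairing than `b`. -/
theorem exists_small_filling {A : List (Lat g)} {f b : Lat g} {R : ℕ} (hbA : OrthList A b)
    (hb : (symp b f).natAbs = R + 1)
    {ζ : Chain g 1} (hζ : ζ ∈ chains (linkCells (SmallOrth A f R) b 1))
    (hfill : ∃ η ∈ chains (linkCells (OrthList A) b 2), diffL g 1 η = ζ) :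
    ∃ ρ ∈ chains (linkCells (SmallOrth A f R) b 2), diffL g 1 ρ = ζ := by
  obtain ⟨η, hη, rfl⟩ := hfill
  let q : Lat g → ℤ := fun v => if (symp v f).natAbs ≤ R then 0 else symp v f / symp b f
  have hq : ∀ v, OrthList A v → SmallOrth A f R (v - q v • b) := by
    intro v hv
    refine ⟨hv.sub_smul hbA _, ?_⟩
    by_cases h : (symp v f).natAbs ≤ R
    · simp [q, h]
    · have h1 : symp (v - q v • b) f = symp v f % symp b f := by
        simp only [q, if_neg h]
        rw [symp_sub_left, symp_smul_left, Int.emod_def]; ring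
      have h2 := natAbs_emod_lt (symp v f) (b := symp b f) (fun h0 => by simp [h0] at hb)
      rw [h1]
      omega
  refine ⟨mapLetters (fun v => v - q v • b) η, ?_, ?_⟩
  · have : chains (linkCells (OrthList A) b 2) ≤
        (chains (linkCells (SmallOrth A f R) b 2)).comap (mapLetters fun v => v - q v • b) := by
      refine chains_le fun w => iSup_le fun hw z hz => ?_
      rw [Submodule.mem_comap, Submodule.mem_comap, Finsupp.lsingle_apply, mapLetters_single]
      exact single_mem_chains (mem_iSup_prop.mpr
        (Or.inr ⟨fun i => hq _ (hw i), coeff_le_shear b w (fun i => q (w i)) hz⟩))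
    exact this hη
  · rw [diffL_mapLetters]
    have : chains (linkCells (SmallOrth A f R) b 1) ≤
        LinearMap.eqLocus (mapLetters fun v => v - q v • b) LinearMap.id := by
      refine chains_le fun w => iSup_le fun hw z _ => ?_
      change mapLetters _ (Finsupp.single w z) = Finsupp.single w z
      rw [mapLetters_single]
      congr 1
      ext1 i
      simp [q, (hw i).2]
    exact this hζ

/-- Lowering the largest pairing of letters with `f`. -/
theorem exists_lower (hg : 7 ≤ g) {A : List (Lat g)} (hA : A.length ≤ 6) (f : Lat g)
    (hfill : ∀ b, ∀ ζ ∈ chains (linkCells (OrthList A) b 1), diffL g 0 ζ = 0 →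
      ∃ η ∈ chains (linkCells (OrthList A) b 2), diffL g 1 η = ζ) (R : ℕ)
    {ξ : Chain g 2} (hξ : ξ ∈ chains (cells (SmallOrth A f (R + 1)) 2)) (hd : diffL g 1 ξ = 0) :
    ∃ ξ' ∈ chains (cells (SmallOrth A f R) 2), ξ - ξ' ∈ boundaries g := by
  classical
  obtain ⟨ξ₁, hξ₁, β, hβ, rfl⟩ :=
    Submodule.mem_sup.mp (chains_cells_le_steepCells hg hA f R hξ)
  rw [map_add, diffL_eq_zero_of_mem_boundaries hβ, add_zero] at hd
  let Bs : Finset (Lat g) :=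
    (ξ₁.support.image fun w => w 0).filter fun b => (symp b f).natAbs = R + 1
  have hBs : ∀ b ∈ Bs, OrthList A b ∧ (symp b f).natAbs = R + 1 := by
    intro b hb
    obtain ⟨hb, hbR⟩ := Finset.mem_filter.mp hb
    obtain ⟨w, hw, rfl⟩ := Finset.mem_image.mp hb
    rcases mem_iSup_prop.mp (hξ₁ w) with h0 | ⟨h, -⟩
    · exact absurd h0 (Finsupp.mem_support_iff.mp hw)
    · exact ⟨h.1.1, hbR⟩
  have hζ : ∀ b, linkPart b ξ₁ ∈ chains (linkCells (SmallOrth A f R) b 1) := by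
    intro b w
    rw [linkPart_apply]
    rcases mem_iSup_prop.mp (hξ₁ (Matrix.vecCons b w)) with h0 | ⟨h, hz⟩
    · rw [h0]; exact Submodule.zero_mem _
    · refine mem_iSup_prop.mpr (Or.inr ⟨fun i => ?_, hz⟩)
      rw [Subsingleton.elim i 0]
      exact h.2
  have hex : ∀ b, ∃ ρ : Chain g 2, b ∈ Bs →
      ρ ∈ chains (linkCells (SmallOrth A f R) b 2) ∧ diffL g 1 ρ = linkPart b ξ₁ := by
    intro b
    by_cases hb : b ∈ Bs
    · obtain ⟨hbA, hbR⟩ := hBs b hb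
      obtain ⟨ρ, h1, h2⟩ := exists_small_filling hbA hbR (hζ b) (hfill b _
        (chains_mono (linkCells_mono (fun v hv => hv.1) b 1) (hζ b))
        (diffL_linkPart_eq_zero (by omega) hξ₁ hd))
      exact ⟨ρ, fun _ => ⟨h1, h2⟩⟩
    · exact ⟨0, fun h => absurd h hb⟩
  choose ρ hρ using hex
  refine ⟨ξ₁ - ∑ b ∈ Bs, cone b (linkPart b ξ₁) + ∑ b ∈ Bs, ρ b, Submodule.add_mem _ ?_ ?_, ?_⟩
  · intro w
    rw [Finsupp.sub_apply, Finsupp.finsetSum_apply]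
    simp only [cone_linkPart_apply, Finset.sum_ite_eq]
    split_ifs with h
    · rw [sub_self]; exact Submodule.zero_mem _
    · rw [sub_zero]
      rcases mem_iSup_prop.mp (hξ₁ w) with h0 | ⟨hw, hz⟩
      · rw [h0]; exact Submodule.zero_mem _
      · by_cases h0 : ξ₁ w = 0
        · rw [h0]; exact Submodule.zero_mem _
        have hne : (symp (w 0) f).natAbs ≠ R + 1 := fun h' => h (Finset.mem_filter.mpr
          ⟨Finset.mem_image_of_mem (fun w => w 0) (Finsupp.mem_support_iff.mpr h0), h'⟩)
        refine mem_iSup_prop.mpr (Or.inr ⟨fun i => ?_, hz⟩)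
        fin_cases i
        · exact ⟨hw.1.1, by have := hw.1.2; simp only [Fin.zero_eta]; omega⟩
        · exact hw.2
  · exact Submodule.sum_mem _ fun b hb => chains_mono (linkCells_le_cells _ b 2) (hρ b hb).1
  · have h1 : ∑ b ∈ Bs, (ρ b - cone b (linkPart b ξ₁)) ∈ boundaries g := by
      refine Submodule.sum_mem _ fun b hb => ?_
      rw [← (hρ b hb).2, ← diffL_cone]
      refine Submodule.mem_map_of_mem ?_
      have : chains (linkCells (SmallOrth A f R) b 2) ≤
          (chains (cells (fun _ => True) 3)).comap (cone b) := by
        refine chains_le fun w => iSup_le fun hw z hz => ?_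
        rw [Submodule.mem_comap, Submodule.mem_comap, Finsupp.lsingle_apply, cone_single]
        exact single_mem_chains (mem_iSup_prop.mpr (Or.inr ⟨fun _ => trivial, hz⟩))
      exact this (hρ b hb).1
    have h2 := Submodule.sub_mem _ hβ h1
    rw [Finset.sum_sub_distrib] at h2
    convert h2 using 1
    abel

/-- Making all letters orthogonal to `f`. -/
theorem exists_orth (hg : 7 ≤ g) {A : List (Lat g)} (hA : A.length ≤ 6) (f : Lat g)
    (hfill : ∀ b, ∀ ζ ∈ chains (linkCells (OrthList A) b 1), diffL g 0 ζ = 0 →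
      ∃ η ∈ chains (linkCells (OrthList A) b 2), diffL g 1 η = ζ)
    {ξ : Chain g 2} (hξ : ξ ∈ chains (cells (OrthList A) 2)) (hd : diffL g 1 ξ = 0) :
    ∃ ξ' ∈ chains (cells (OrthList (f :: A)) 2), ξ - ξ' ∈ boundaries g := by
  have key : ∀ (R : ℕ) (ξ : Chain g 2), ξ ∈ chains (cells (SmallOrth A f R) 2) →
      diffL g 1 ξ = 0 →
      ∃ ξ' ∈ chains (cells (OrthList (f :: A)) 2), ξ - ξ' ∈ boundaries g := by
    intro R
    induction R with
    | zero =>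
      intro ξ hξ _
      refine ⟨ξ, chains_mono (cells_mono (fun v hv => ?_) 2) hξ, by simp⟩
      exact List.forall_mem_cons.mpr ⟨by have := hv.2; omega, hv.1⟩
    | succ R ih =>
      intro ξ hξ hd
      obtain ⟨ξ₁, hξ₁, hb₁⟩ := exists_lower hg hA f hfill R hξ hd
      have h1 := diffL_eq_zero_of_mem_boundaries hb₁
      rw [map_sub, hd, zero_sub, neg_eq_zero] at h1
      obtain ⟨ξ₂, hξ₂, hb₂⟩ := ih ξ₁ hξ₁ h1
      exact ⟨ξ₂, hξ₂, by simpa using Submodule.add_mem _ hb₁ hb₂⟩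
  refine key (ξ.support.sup fun w => Finset.univ.sup fun i => (symp (w i) f).natAbs) ξ ?_ hd
  intro w
  by_cases h0 : ξ w = 0
  · rw [h0]; exact Submodule.zero_mem _
  · rcases mem_iSup_prop.mp (hξ w) with h | ⟨hw, hz⟩
    · exact absurd h h0
    · refine mem_iSup_prop.mpr (Or.inr ⟨fun i => ⟨hw i, ?_⟩, hz⟩)
      exact (Finset.le_sup (f := fun i => (symp (w i) f).natAbs) (Finset.mem_univ i)).trans
        (Finset.le_sup (f := fun w : Fin 2 → Lat g =>
          Finset.univ.sup fun i => (symp (w i) f).natAbs) (Finsupp.mem_support_iff.mpr h0))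

/-- Making all letters orthogonal to the vectors of a list of vectors of the standard frame. -/
theorem exists_orth_list (hg : 7 ≤ g) (F : List (Lat g)) (hF : F.length ≤ 4)
    (hFs : ∀ v ∈ F, v ∈ Set.range (stdFrame g)) {ξ : Chain g 2}
    (hξ : ξ ∈ chains (cells (OrthList []) 2)) (hd : diffL g 1 ξ = 0) :
    ∃ ξ' ∈ chains (cells (OrthList F) 2), ξ - ξ' ∈ boundaries g := by
  induction F with
  | nil => exact ⟨ξ, hξ, by simp⟩
  | cons f F ih =>
    rw [List.length_cons] at hF
    obtain ⟨ξ₁, hξ₁, hb₁⟩ := ih (by omega) fun v hv => hFs v (List.mem_cons_of_mem f hv)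
    have h1 := diffL_eq_zero_of_mem_boundaries hb₁
    rw [map_sub, hd, zero_sub, neg_eq_zero] at h1
    obtain ⟨ξ₂, hξ₂, hb₂⟩ := exists_orth hg (by omega) f (fun b ζ hζ hdζ => by
      obtain ⟨f', u', hf', hstd, hb⟩ := exists_isFrame hg b
      refine exists_filling_link hg (by omega) hf' (fun k a ha => ?_) hb hζ hdζ
      obtain ⟨i, rfl⟩ := hFs a (List.mem_cons_of_mem f ha)
      exact hstd k i) hξ₁ h1
    exact ⟨ξ₂, hξ₂, by simpa using Submodule.add_mem _ hb₁ hb₂⟩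

/-- Closed chains of degree two bound. -/
theorem mem_boundaries (hg : 7 ≤ g) {ξ : Chain g 2}
    (hξ : ξ ∈ chains (cells (OrthList []) 2)) (hd : diffL g 1 ξ = 0) : ξ ∈ boundaries g := by
  obtain ⟨ξ₁, hξ₁, hb₁⟩ := exists_orth_list hg (List.ofFn (stdFrame g))
    (by rw [List.length_ofFn]) (fun v hv => List.mem_ofFn.mp hv) hξ hd
  have h1 := diffL_eq_zero_of_mem_boundaries hb₁
  rw [map_sub, hd, zero_sub, neg_eq_zero] at h1
  obtain ⟨u, hu⟩ := exists_isFrame_stdFrame hg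
  obtain ⟨π, hπ⟩ := hu.exists_splitting
  obtain ⟨η, hη, rfl⟩ := exists_filling (T' := cells (fun _ => True) 3) (stdFrame g) π
    (fun w z hz => by
      rcases mem_iSup_prop.mp hz with rfl | ⟨hw, hz⟩
      · simp
      obtain ⟨h1, h2⟩ := hπ w (fun i k => hw i _ (List.mem_ofFn.mpr ⟨k, rfl⟩)) z hz
      exact ⟨h1, fun k => mem_iSup_prop.mpr (Or.inr ⟨fun _ => trivial, h2 k⟩)⟩) hξ₁ h1
  simpa using Submodule.add_mem _ hb₁ (Submodule.mem_map_of_mem hη)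

end Filling

/-- exactness of `C_3 → C_2 → C_1` at `C_2` for the complex `Λ(g)`. -/
theorem stmt0 (g : ℕ) (hg : 7 ≤ g)
    (ξ : (Fin 2 → Fin (2 * g) → ℤ) →₀ ExteriorAlgebra ℚ (Fin (2 * g) → ℚ))
    (hsupp : ∀ w, ¬(PairwiseOrth w ∧ IsUnimodular w) → ξ w = 0)
    (hval : ∀ w, ξ w ∈ wedge3 (perp (Set.range fun i => qcast (w i))))
    (hclosed : diff g 1 ξ = 0) :
    ∃ η : (Fin 3 → Fin (2 * g) → ℤ) →₀ ExteriorAlgebra ℚ (Fin (2 * g) → ℚ),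
      (∀ w, ¬(PairwiseOrth w ∧ IsUnimodular w) → η w = 0) ∧
      (∀ w, η w ∈ wedge3 (perp (Set.range fun i => qcast (w i)))) ∧
      diff g 2 η = ξ := by
  have hξ : ξ ∈ chains (cells (OrthList []) 2) := by
    intro w
    by_cases hw : IsSimplex w
    · refine mem_iSup_prop.mpr (Or.inr ⟨fun i => List.forall_mem_nil _, ?_⟩)
      rw [coeff_of_isSimplex hw]
      exact hval w
    · rw [hsupp w hw]; exact Submodule.zero_mem _
  obtain ⟨η, hη, rfl⟩ := mem_boundaries hg hξ (by rw [← diff_eq_diffL, hclosed])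
  have hη' : ∀ w, η w ∈ coeff w := fun w =>
    (iSup_le fun _ => le_rfl : cells (fun _ => True) 3 w ≤ coeff w) (hη w)
  refine ⟨η, fun w hw => ?_, fun w => ?_, diff_eq_diffL 2 η⟩
  · exact (Submodule.mem_bot ℚ).mp ((coeff_le fun h => absurd h hw : coeff w ≤ ⊥) (hη' w))
  · exact (coeff_le fun _ => le_rfl : coeff w ≤ wedge3 (perpWord w)) (hη' w)

end Paper
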